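/- arXiv:2601.06264 — 5 statements merged into one kernel-verified Lean document; each statement's English description precedes it below -/
import Mathlib

section
/- Let T = (V,E) be a tree (a connected acyclic simple graph) on the vertex set V = {1,…,d} with d ≥ 2, and let Ψ = (ψ_{ij}) be a symmetric real matrix with zero diagonal such that ψ_{ij} = 0 whenever {i,j} ∉ E. Then for every o ∈ {−1,1}^d the Ising weight factorizes over the edges of the tree: γ_o(Ψ) = ∏_{{i,j} ∈ E} m_{ij}^{1{o_i o_j = 1}} (1 − m_{ij})^{1{o_i o_j = −1}}, where m_{ij} := exp(2ψ_{ij})/(1 + exp(2ψ_{ij})) ∈ (0,1). -/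
open Finset
open scoped Classical

/-- The sign ±1 associated to a boolean. -/
noncomputable def bsign (b : Bool) : ℝ := if b then 1 else -1

/-- The Ising interaction sum `S_Ψ(o) = Σ_{i<j} ψ_{ij} o_i o_j`. -/
noncomputable def isingS (d : ℕ) (Ψ : Fin d → Fin d → ℝ) (o : Fin d → Bool) : ℝ :=
  ∑ i : Fin d, ∑ j : Fin d, if i < j then Ψ i j * bsign (o i) * bsign (o j) else 0

/-- The Ising normalizing constant `C(Ψ) = Σ_o exp(S_Ψ(o))`. -/
noncomputable def isingC (d : ℕ) (Ψ : Fin d → Fin d → ℝ) : ℝ :=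
  ∑ o : Fin d → Bool, Real.exp (isingS d Ψ o)

/-- The Ising weight `γ_o(Ψ) = 2 exp(S_Ψ(o)) / C(Ψ)`. -/
noncomputable def isingWeight (d : ℕ) (Ψ : Fin d → Fin d → ℝ) (o : Fin d → Bool) : ℝ :=
  2 * Real.exp (isingS d Ψ o) / isingC d Ψ

/-- The edges of `G`, each recorded as the pair of its endpoints in increasing order. -/
abbrev SimpleGraph.OrderedEdge {V : Type*} [LT V] (G : SimpleGraph V) : Type _ :=
  {p : V × V // p.1 < p.2 ∧ G.Adj p.1 p.2}

theorem SimpleGraph.card_orderedEdge {V : Type*} [LinearOrder V] [Fintype V]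
    (G : SimpleGraph V) : Fintype.card G.OrderedEdge = #G.edgeFinset := by
  rw [SimpleGraph.edgeFinset_card]
  refine Fintype.card_congr (Equiv.ofBijective
    (fun e : G.OrderedEdge => (⟨s(e.1.1, e.1.2), e.2.2⟩ : G.edgeSet)) ⟨?_, ?_⟩)
  · rintro ⟨⟨a, b⟩, hab, _⟩ ⟨⟨c, d⟩, hcd, _⟩ h
    obtain ⟨rfl, rfl⟩ | ⟨rfl, rfl⟩ := Sym2.eq_iff.mp (congrArg Subtype.val h)
    · rfl
    · exact absurd hab (lt_asymm hcd)
  · rintro ⟨e, he⟩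
    induction e with
    | _ a b =>
      rcases lt_or_gt_of_ne (G.ne_of_adj he) with h | h
      · exact ⟨⟨(a, b), h, he⟩, rfl⟩
      · exact ⟨⟨(b, a), h, he.symm⟩, Subtype.ext Sym2.eq_swap⟩

/-- A two-colouring of the vertices of a tree is the same thing as the colour of a root together
with the choice, for each edge, of whether its endpoints agree. -/
theorem SimpleGraph.IsTree.bijective_root_agreement {V : Type*} [LinearOrder V] [Fintype V]
    {G : SimpleGraph V} (hG : G.IsTree) (r : V) :
    Function.Bijective fun o : V → Bool =>
      (o r, fun e : G.OrderedEdge => o e.1.1 == o e.1.2) := by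
  rw [Fintype.bijective_iff_injective_and_card]
  constructor
  · intro o o' h
    simp only [Prod.mk.injEq] at h
    obtain ⟨hr, he⟩ := h
    have hadj : ∀ a b, G.Adj a b → (o a == o b) = (o' a == o' b) := by
      intro a b hab
      rcases lt_or_gt_of_ne (G.ne_of_adj hab) with hlt | hlt
      · exact congrFun he ⟨(a, b), hlt, hab⟩
      · simpa only [Bool.beq_comm] using congrFun he ⟨(b, a), hlt, hab.symm⟩
    have hcancel : ∀ x y z : Bool, (x == y) = (x == z) → y = z := by decide
    funext v
    obtain ⟨w⟩ := hG.connected r v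
    induction w with
    | nil => exact hr
    | cons hab _ ih =>
      apply ih
      exact hcancel _ _ _ (hr ▸ hadj _ _ hab)
  · have h := hG.card_edgeFinset
    rw [← G.card_orderedEdge] at h
    simp [← h, pow_succ, mul_comm]

theorem SimpleGraph.IsTree.sum_prod_agreement {V R : Type*} [LinearOrder V] [Fintype V]
    [CommSemiring R] {G : SimpleGraph V} (hG : G.IsTree) (f : G.OrderedEdge → Bool → R) :
    ∑ o : V → Bool, ∏ e : G.OrderedEdge, f e (o e.1.1 == o e.1.2) =
      2 * ∏ e : G.OrderedEdge, (f e true + f e false) := by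
  obtain ⟨r⟩ := hG.connected.nonempty
  rw [(hG.bijective_root_agreement r).sum_comp
    (fun p : Bool × (G.OrderedEdge → Bool) => ∏ e, f e (p.2 e)), Fintype.sum_prod_type]
  simp [← Fintype.prod_sum, two_mul]

theorem SimpleGraph.prod_prod_ite_lt_adj {V M : Type*} [LinearOrder V] [Fintype V]
    [CommMonoid M] (G : SimpleGraph V) (f : V → V → M) :
    (∏ i, ∏ j, if i < j ∧ G.Adj i j then f i j else 1) =
      ∏ e : G.OrderedEdge, f e.1.1 e.1.2 := by
  rw [← Fintype.prod_prod_type' fun i j => if i < j ∧ G.Adj i j then f i j else 1,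
    ← Finset.prod_filter]
  exact Finset.prod_subtype _ (by simp) _

theorem bsign_mul_bsign (a b : Bool) : bsign a * bsign b = bsign (a == b) := by
  cases a <;> cases b <;> simp [bsign]

theorem exp_isingS_eq_prod {d : ℕ} {G : SimpleGraph (Fin d)} {Ψ : Fin d → Fin d → ℝ}
    (hsupp : ∀ i j, ¬ G.Adj i j → Ψ i j = 0) (o : Fin d → Bool) :
    Real.exp (isingS d Ψ o) =
      ∏ e : G.OrderedEdge, Real.exp (Ψ e.1.1 e.1.2 * bsign (o e.1.1 == o e.1.2)) := by
  rw [← G.prod_prod_ite_lt_adj fun i j => Real.exp (Ψ i j * bsign (o i == o j)), isingS,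
    Real.exp_sum]
  refine Finset.prod_congr rfl fun i _ => ?_
  rw [Real.exp_sum]
  refine Finset.prod_congr rfl fun j _ => ?_
  by_cases hadj : G.Adj i j
  · by_cases hlt : i < j <;> simp [hadj, hlt, mul_assoc, bsign_mul_bsign]
  · simp [hadj, hsupp i j hadj]

theorem isingC_eq_of_isTree {d : ℕ} {G : SimpleGraph (Fin d)} (hG : G.IsTree)
    {Ψ : Fin d → Fin d → ℝ} (hsupp : ∀ i j, ¬ G.Adj i j → Ψ i j = 0) :
    isingC d Ψ =
      2 * ∏ e : G.OrderedEdge, (Real.exp (Ψ e.1.1 e.1.2) + Real.exp (-Ψ e.1.1 e.1.2)) := by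
  simp only [isingC, exp_isingS_eq_prod hsupp]
  rw [hG.sum_prod_agreement fun e b => Real.exp (Ψ e.1.1 e.1.2 * bsign b)]
  simp [bsign]

/-- The two-point Ising weight in terms of the probability `exp (2 x) / (1 + exp (2 x))` that two
neighbouring spins agree. -/
theorem logistic_pow_mul_pow_eq (x : ℝ) (b : Bool) :
    (Real.exp (2 * x) / (1 + Real.exp (2 * x))) ^ (if bsign b = 1 then (1 : ℕ) else 0) *
        (1 - Real.exp (2 * x) / (1 + Real.exp (2 * x))) ^
          (if bsign b = -1 then (1 : ℕ) else 0) =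
      Real.exp (x * bsign b) / (Real.exp x + Real.exp (-x)) := by
  have hx := Real.exp_pos x
  rw [two_mul, Real.exp_add, Real.exp_neg]
  cases b
  · norm_num [bsign, Real.exp_neg]
    field_simp
    ring
  · norm_num [bsign]
    field_simp
    ring

/-- for a tree `G` on `{1,…,d}` and an Ising parameter matrix `Ψ`
supported on the edges of `G`, the Ising weight factorizes over the edges of the
tree as `γ_o(Ψ) = ∏_{{i,j}∈E} m_{ij}^{1{o_i o_j = 1}} (1 − m_{ij})^{1{o_i o_j = −1}}`,
where `m_{ij} = exp(2ψ_{ij})/(1 + exp(2ψ_{ij}))`. -/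
theorem ising_tree_factorization
    (d : ℕ) (hd : 2 ≤ d) (G : SimpleGraph (Fin d)) (hT : G.IsTree)
    (Ψ : Fin d → Fin d → ℝ)
    (hsym : ∀ i j, Ψ i j = Ψ j i) (hdiag : ∀ i, Ψ i i = 0)
    (hsupp : ∀ i j, ¬ G.Adj i j → Ψ i j = 0)
    (o : Fin d → Bool) :
    isingWeight d Ψ o =
      ∏ i : Fin d, ∏ j : Fin d,
        if i < j ∧ G.Adj i j then
          (Real.exp (2 * Ψ i j) / (1 + Real.exp (2 * Ψ i j))) ^
              (if bsign (o i) * bsign (o j) = 1 then (1 : ℕ) else 0) *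
            (1 - Real.exp (2 * Ψ i j) / (1 + Real.exp (2 * Ψ i j))) ^
              (if bsign (o i) * bsign (o j) = -1 then (1 : ℕ) else 0)
        else 1 := by
  simp only [bsign_mul_bsign, logistic_pow_mul_pow_eq]
  rw [G.prod_prod_ite_lt_adj fun i j =>
    Real.exp (Ψ i j * bsign (o i == o j)) / (Real.exp (Ψ i j) + Real.exp (-Ψ i j)),
    Finset.prod_div_distrib, ← exp_isingS_eq_prod hsupp, isingWeight,
    isingC_eq_of_isTree hT hsupp, mul_div_mul_left _ _ two_ne_zero]
end

section
/- Fix d ≥ 2, a symmetric real matrix Ψ = (ψ_{ij}) with zero diagonal, and two distinct indices i ≠ j in {1,…,d}. There exist strictly positive functions p, depending only on the coordinates (o_k)_{k ≠ j}, and q, depending only on the coordinates (o_k)_{k ≠ i}, such that exp(S_Ψ(o)) = p((o_k)_{k≠j}) · q((o_k)_{k≠i}) for all o ∈ {−1,1}^d, if and only if ψ_{ij} = 0. -/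
open Finset

open Function in
/-- The mixed second difference of `isingS` in the coordinates `i` and `j`. -/
theorem isingS_mixed_difference {d : ℕ} {Ψ : Fin d → Fin d → ℝ}
    (hsym : ∀ i j, Ψ i j = Ψ j i) {i j : Fin d} (hij : i ≠ j) (o : Fin d → Bool) :
    isingS d Ψ o - isingS d Ψ (update o j true) - isingS d Ψ (update o i true)
      + isingS d Ψ (update (update o i true) j true)
      = Ψ i j * (bsign (o i) - 1) * (bsign (o j) - 1) := by
  have hterm : ∀ a b : Fin d,
      (if a < b then Ψ a b * bsign (o a) * bsign (o b) else 0)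
      - (if a < b then Ψ a b * bsign (update o j true a) * bsign (update o j true b) else 0)
      - (if a < b then Ψ a b * bsign (update o i true a) * bsign (update o i true b) else 0)
      + (if a < b then Ψ a b * bsign (update (update o i true) j true a)
          * bsign (update (update o i true) j true b) else 0)
      = (if a = i then if b = j then
          if i < j then Ψ i j * (bsign (o i) - 1) * (bsign (o j) - 1) else 0 else 0 else 0)
      + (if a = j then if b = i then
          if j < i then Ψ i j * (bsign (o i) - 1) * (bsign (o j) - 1) else 0 else 0 else 0) := by
    intro a b
    have ht : bsign true = 1 := by simp [bsign]
    by_cases hab : a < b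
    · have hne := hab.ne
      simp only [hab, if_true, update_apply]
      have hs := hsym i j
      by_cases hai : a = i <;> by_cases haj : a = j <;> by_cases hbi : b = i <;>
        by_cases hbj : b = j <;> subst_vars <;> simp_all <;> ring
    · simp only [hab, if_false]
      by_cases hai : a = i <;> by_cases haj : a = j <;> by_cases hbi : b = i <;>
        by_cases hbj : b = j <;> subst_vars <;> simp_all
  simp only [isingS, ← Finset.sum_sub_distrib, ← Finset.sum_add_distrib, hterm]
  simp only [Finset.sum_add_distrib]
  rcases lt_or_gt_of_ne hij with h | h <;>
    simp [h, h.not_gt, Finset.sum_ite_irrel]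

/-- `exp(S_Ψ(o))` factorizes into a strictly positive function `p` of the
coordinates `(o_k)_{k ≠ j}` times a strictly positive function `q` of the coordinates
`(o_k)_{k ≠ i}` if and only if `ψ_{ij} = 0`. -/
theorem ising_exp_factorization_iff
    (d : ℕ) (hd : 2 ≤ d) (Ψ : Fin d → Fin d → ℝ)
    (hsym : ∀ i j, Ψ i j = Ψ j i) (hdiag : ∀ i, Ψ i i = 0)
    (i j : Fin d) (hij : i ≠ j) :
    (∃ (p : ({k : Fin d // k ≠ j} → Bool) → ℝ) (q : ({k : Fin d // k ≠ i} → Bool) → ℝ),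
      (∀ u, 0 < p u) ∧ (∀ u, 0 < q u) ∧
      ∀ o : Fin d → Bool,
        Real.exp (isingS d Ψ o) = p (fun k => o k.1) * q (fun k => o k.1)) ↔
    Ψ i j = 0 := by
  have hdiff := fun o => isingS_mixed_difference hsym hij o
  constructor
  · rintro ⟨p, q, hp, hq, h⟩
    have hpj : ∀ o : Fin d → Bool,
        (fun k : {k : Fin d // k ≠ j} => Function.update o j true k.1) = fun k => o k.1 := by
      intro o; funext k; simp [k.2]
    have hqi : ∀ o : Fin d → Bool,
        (fun k : {k : Fin d // k ≠ i} => Function.update o i true k.1) = fun k => o k.1 := by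
      intro o; funext k; simp [k.2]
    set o : Fin d → Bool := fun _ => false with ho
    have h₀ := h o
    have h₁ := h (Function.update o j true)
    have h₂ := h (Function.update o i true)
    have h₃ := h (Function.update (Function.update o i true) j true)
    rw [hpj] at h₁ h₃
    rw [hqi] at h₂
    rw [Function.update_comm hij, hqi, Function.update_comm hij.symm] at h₃
    have hexp : Real.exp (isingS d Ψ o
          + isingS d Ψ (Function.update (Function.update o i true) j true))
        = Real.exp (isingS d Ψ (Function.update o j true)
          + isingS d Ψ (Function.update o i true)) := by
      rw [Real.exp_add, Real.exp_add, h₀, h₁, h₂, h₃]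
      ring
    have heq := Real.exp_injective hexp
    have hd₀ := hdiff o
    have hf : ∀ k, bsign (o k) = -1 := by simp [ho, bsign]
    simp only [hf] at hd₀
    linarith
  · intro hΨ
    refine ⟨fun u => Real.exp (isingS d Ψ fun k => if hk : k ≠ j then u ⟨k, hk⟩ else true),
      fun v => Real.exp (isingS d Ψ (fun k => if hk : k ≠ i then v ⟨k, hk⟩ else true)
        - isingS d Ψ (Function.update (fun k => if hk : k ≠ i then v ⟨k, hk⟩ else true) j true)),
      fun _ => Real.exp_pos _, fun _ => Real.exp_pos _, fun o => ?_⟩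
    have hupd : ∀ l : Fin d,
        (fun k => if _ : k ≠ l then o k else true) = Function.update o l true := by
      intro l; funext k; by_cases hk : k = l <;> simp [hk]
    have hd₀ := hdiff o
    rw [hΨ, zero_mul, zero_mul] at hd₀
    simp only [hupd]
    rw [← Real.exp_add]
    congr 1
    linarith
end

section
/- Let m₁, m₂ ∈ (0,1) and for o = (o₁,o₂,o₃) ∈ {−1,1}³ define γ_o := (m₁·1{o₁o₃ = 1} + (1−m₁)·1{o₁o₃ = −1}) · (m₂·1{o₂o₃ = 1} + (1−m₂)·1{o₂o₃ = −1}). If there exist strictly positive functions f, h : {−1,1}² → (0,∞) such that γ_o = f(o₁,o₂)·h(o₂,o₃) for all o ∈ {−1,1}³, then m₁ = 1/2. -/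
open scoped Classical

/-- The orthant weights of Example 3.3:
`γ_o = (m₁·1{o₁o₃=1} + (1−m₁)·1{o₁o₃=−1}) · (m₂·1{o₂o₃=1} + (1−m₂)·1{o₂o₃=−1})`. -/
noncomputable def gammaEx (m₁ m₂ : ℝ) (o : Fin 3 → Bool) : ℝ :=
  (m₁ * (if bsign (o 0) * bsign (o 2) = 1 then (1 : ℝ) else 0) +
      (1 - m₁) * (if bsign (o 0) * bsign (o 2) = -1 then (1 : ℝ) else 0)) *
    (m₂ * (if bsign (o 1) * bsign (o 2) = 1 then (1 : ℝ) else 0) +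
      (1 - m₂) * (if bsign (o 1) * bsign (o 2) = -1 then (1 : ℝ) else 0))

/-- Each factor of the weight only depends on whether two of the signs agree. -/
lemma gammaEx_vec (m₁ m₂ : ℝ) (a b c : Bool) :
    gammaEx m₁ m₂ ![a, b, c] =
      (if a = c then m₁ else 1 - m₁) * (if b = c then m₂ else 1 - m₂) := by
  have h₀ : ![a, b, c] 0 = a := rfl
  have h₁ : ![a, b, c] 1 = b := rfl
  have h₂ : ![a, b, c] 2 = c := rfl
  rw [gammaEx, h₀, h₁, h₂]
  cases a <;> cases b <;> cases c <;> norm_num [bsign]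

/-- if the weights `γ_o` factorize as `f(o₁,o₂)·h(o₂,o₃)` with strictly
positive `f, h`, then `m₁ = 1/2`. -/
theorem gammaEx_factorization_implies_half
    (m₁ m₂ : ℝ) (hm₁ : m₁ ∈ Set.Ioo (0 : ℝ) 1) (hm₂ : m₂ ∈ Set.Ioo (0 : ℝ) 1)
    (f h : Bool → Bool → ℝ)
    (hf : ∀ a b, 0 < f a b) (hh : ∀ a b, 0 < h a b)
    (hfac : ∀ o : Fin 3 → Bool, gammaEx m₁ m₂ o = f (o 0) (o 1) * h (o 1) (o 2)) :
    m₁ = 1 / 2 := by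
  have cross : gammaEx m₁ m₂ ![true, true, true] * gammaEx m₁ m₂ ![false, true, false] =
      gammaEx m₁ m₂ ![true, true, false] * gammaEx m₁ m₂ ![false, true, true] := by
    simp only [hfac, Matrix.cons_val]
    ring
  simp [gammaEx_vec] at cross
  obtain ⟨hm₂_pos, hm₂_lt⟩ := hm₂
  have hpos : 0 < m₂ * (1 - m₂) := mul_pos hm₂_pos (sub_pos.mpr hm₂_lt)
  have hzero : m₂ * (1 - m₂) * (2 * m₁ - 1) = 0 := by linear_combination cross
  have := (mul_eq_zero.mp hzero).resolve_left hpos.ne'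
  linarith
end

section
/- Let d ≥ 2 and let f : ℝ^d → [0,∞) be Lebesgue integrable and satisfy: (i) the marginal functions f_i(x_i) := ∫_{ℝ^{d−1}} f(x) dx_{∖i} and f_{ij}(x_i,x_j) := ∫_{ℝ^{d−2}} f(x) dx_{∖{i,j}} are uniformly bounded for all i ≠ j; (ii) f is continuous, for every j the partial derivative ∂_j f(x) exists at every x ∈ ℝ^d, and for each fixed x_{∖j} the map x_j ↦ ∂_j f(x) is continuous; (iii) for every a ∈ ℝ and j ∈ {1,…,d} there exist ε > 0 and a function M : ℝ^{d−1} → [0,∞) with ∫_{ℝ^{d−1}} M(x_{∖j}) dx_{∖j} < ∞ such that sup_{|x_j − a| ≤ ε} |∂_j f(x)| ≤ M(x_{∖j}) for all x_{∖j} ∈ ℝ^{d−1}, and for every i ≠ j the map x_i ↦ ∫_{ℝ^{d−2}} M(x_{∖j}) dx_{∖{i,j}} is bounded on bounded sets; (iv) for every j the map x_j ↦ ∫_{ℝ^{d−1}} |∂_j f(x)| dx_{∖j} is uniformly bounded. Then for every nonempty subset I ⊆ {1,…,d}, the function F_I : ℝ^{|I|} → [0,∞) given by F_I(z) := ∫_{{y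 ∈ ℝ^d : y_i ≤ z_i for all i ∈ I}} f(y) dy is twice continuously differentiable with uniformly bounded first and second order partial derivatives. -/
open MeasureTheory Finset

/-- Fill the coordinates other than `j` with `y` and coordinate `j` with `t`. -/
noncomputable def fill1 {d : ℕ} (j : Fin d) (t : ℝ) (y : {k : Fin d // k ≠ j} → ℝ) :
    Fin d → ℝ := fun k => if h : k = j then t else y ⟨k, h⟩

/-- Fill the coordinates other than `i, j` with `y`, coordinate `i` with `s` and
coordinate `j` with `t`. -/
noncomputable def fill2 {d : ℕ} (i j : Fin d) (s t : ℝ)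
    (y : {k : Fin d // k ≠ i ∧ k ≠ j} → ℝ) : Fin d → ℝ :=
  fun k => if h : k = i then s else if h' : k = j then t else y ⟨k, ⟨h, h'⟩⟩

/-- Fill, inside the coordinates other than `j`, the coordinate `i` with `s` and the
remaining coordinates with `z`. -/
noncomputable def fillSub {d : ℕ} (j i : Fin d) (s : ℝ)
    (z : {k : Fin d // k ≠ i ∧ k ≠ j} → ℝ) : {k : Fin d // k ≠ j} → ℝ :=
  fun k => if h : k.1 = i then s else z ⟨k.1, ⟨h, k.2⟩⟩

/-- The function `F_I(z) = ∫_{y : y_i ≤ z_i ∀ i ∈ I} f(y) dy`. -/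
noncomputable def cdfI (d : ℕ) (f : (Fin d → ℝ) → ℝ) (I : Finset (Fin d))
    (z : {i : Fin d // i ∈ I} → ℝ) : ℝ :=
  ∫ y in {y : Fin d → ℝ | ∀ i : {i : Fin d // i ∈ I}, y i.1 ≤ z i}, f y

open Filter Topology

section PartialDerivatives

variable {ι : Type*} [Fintype ι]

theorem norm_pi_proj_le_one (i : ι) :
    ‖ContinuousLinearMap.proj (R := ℝ) (φ := fun _ : ι => ℝ) i‖ ≤ 1 :=
  ContinuousLinearMap.opNorm_le_bound _ zero_le_one fun x => by simpa using norm_le_pi_norm x i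

variable [DecidableEq ι]

/-- A function on `ι → ℝ` with continuous partial derivatives is differentiable. -/
theorem hasFDerivAt_of_continuous_partials {F : (ι → ℝ) → ℝ} {G : ι → (ι → ℝ) → ℝ}
    (hG : ∀ i, Continuous (G i))
    (hF : ∀ i z, HasDerivAt (fun t => F (Function.update z i t)) (G i z) (z i)) (z : ι → ℝ) :
    HasFDerivAt F (∑ i, G i z • ContinuousLinearMap.proj (R := ℝ) (φ := fun _ : ι => ℝ) i) z := by
  have key : ∀ s : Finset ι,
      (fun w : ι → ℝ => F (s.piecewise w z) - F z - ∑ i ∈ s, G i z * (w i - z i))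
        =o[𝓝 z] fun w => w - z := by
    intro s
    induction s using Finset.induction_on with
    | empty => simp
    | insert a s ha ih =>
      have step : (fun w : ι → ℝ => F ((insert a s).piecewise w z) - F (s.piecewise w z)
          - G a z * (w a - z a)) =o[𝓝 z] fun w => w - z := by
        rw [Asymptotics.isLittleO_iff]
        intro ε hε
        obtain ⟨δ, hδ, hball⟩ := Metric.continuousAt_iff.1 (hG a).continuousAt ε hε
        filter_upwards [Metric.ball_mem_nhds z hδ] with w hw
        set p := s.piecewise w z with hp
        have hpa : p a = z a := by simp [hp, ha]
        have hder : ∀ t : ℝ, HasDerivAt (fun t => F (Function.update p a t) - G a z * t)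
            (G a (Function.update p a t) - G a z) t := by
          intro t
          have h1 := hF a (Function.update p a t)
          simp only [Function.update_idem, Function.update_self] at h1
          simpa using h1.fun_sub ((hasDerivAt_id t).const_mul (G a z))
        have hbound : ∀ t ∈ Set.uIcc (z a) (w a),
            ‖G a (Function.update p a t) - G a z‖ ≤ ε := by
          intro t ht
          rw [← dist_eq_norm]
          refine (hball ?_).le
          rw [dist_pi_lt_iff hδ]
          rw [Metric.mem_ball, dist_pi_lt_iff hδ] at hw
          intro b
          by_cases hb : b = a
          · subst hb
            rw [Function.update_self]
            refine lt_of_le_of_lt ?_ (hw b)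
            rw [Real.dist_eq, Real.dist_eq]
            exact Set.abs_sub_left_of_mem_uIcc ht
          · rw [Function.update_of_ne hb]
            by_cases hbs : b ∈ s
            · simpa [hp, hbs] using hw b
            · simpa [hp, hbs] using hδ
        have hmv := (convex_uIcc (z a) (w a)).norm_image_sub_le_of_norm_hasDerivWithin_le
          (fun t _ => (hder t).hasDerivWithinAt) hbound Set.left_mem_uIcc Set.right_mem_uIcc
        have h1 : (insert a s).piecewise w z = Function.update p a (w a) :=
          Finset.piecewise_insert s w z a
        have h2 : Function.update p a (z a) = p := by rw [← hpa, Function.update_eq_self]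
        rw [h1]
        rw [h2] at hmv
        calc _ = ‖F (Function.update p a (w a)) - G a z * w a - (F p - G a z * z a)‖ := by
              congr 1; ring
          _ ≤ ε * ‖w a - z a‖ := hmv
          _ ≤ ε * ‖w - z‖ := by gcongr; exact norm_le_pi_norm (w - z) a
      refine (ih.add step).congr_left fun w => ?_
      rw [Finset.sum_insert ha]
      ring
  rw [hasFDerivAt_iff_isLittleO]
  refine (key Finset.univ).congr_left fun w => ?_
  simp

/-- `F` has partial derivatives in all coordinate directions, which are continuous and bounded. -/
def HasPartialsBdd (F : (ι → ℝ) → ℝ) (G : ι → (ι → ℝ) → ℝ) : Prop :=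
  ∀ i, Continuous (G i) ∧ (∃ K, ∀ z, |G i z| ≤ K) ∧
    ∀ z, HasDerivAt (fun t => F (Function.update z i t)) (G i z) (z i)

theorem HasPartialsBdd.contDiff_one {F : (ι → ℝ) → ℝ} {G : ι → (ι → ℝ) → ℝ}
    (h : HasPartialsBdd F G) : ContDiff ℝ 1 F := by
  rw [contDiff_one_iff_hasFDerivAt]
  exact ⟨_, continuous_finsetSum _ fun i _ => (h i).1.smul continuous_const,
    hasFDerivAt_of_continuous_partials (fun i => (h i).1) fun i => (h i).2.2⟩

theorem HasPartialsBdd.fderiv_eq {F : (ι → ℝ) → ℝ} {G : ι → (ι → ℝ) → ℝ}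
    (h : HasPartialsBdd F G) : fderiv ℝ F =
      fun z => ∑ i, G i z • ContinuousLinearMap.proj (R := ℝ) (φ := fun _ : ι => ℝ) i :=
  funext fun z =>
    (hasFDerivAt_of_continuous_partials (fun i => (h i).1) (fun i => (h i).2.2) z).fderiv

theorem HasPartialsBdd.exists_norm_fderiv_le {F : (ι → ℝ) → ℝ} {G : ι → (ι → ℝ) → ℝ}
    (h : HasPartialsBdd F G) : ∃ K, ∀ z, ‖fderiv ℝ F z‖ ≤ K := by
  choose K hK using fun i => (h i).2.1
  refine ⟨∑ i, K i, fun z => ?_⟩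
  rw [h.fderiv_eq]
  refine norm_sum_le_of_le _ fun i _ => ?_
  rw [norm_smul]
  exact (mul_le_of_le_one_right (norm_nonneg _) (norm_pi_proj_le_one i)).trans (hK i z)

/-- A function whose first and second partial derivatives are continuous and bounded is of class
`C²` with bounded first and second Fréchet derivatives. -/
theorem HasPartialsBdd.contDiff_two {F : (ι → ℝ) → ℝ} {G : ι → (ι → ℝ) → ℝ}
    {H : ι → ι → (ι → ℝ) → ℝ} (h : HasPartialsBdd F G) (hG : ∀ i, HasPartialsBdd (G i) (H i)) :
    ContDiff ℝ 2 F ∧ ∃ K, ∀ z, ‖fderiv ℝ F z‖ ≤ K ∧ ‖fderiv ℝ (fderiv ℝ F) z‖ ≤ K := by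
  have hdiff : ∀ i, ContDiff ℝ 1 (G i) := fun i => (hG i).contDiff_one
  refine ⟨?_, ?_⟩
  · have h2 : (2 : WithTop ℕ∞) = ((1 : ℕ) : WithTop ℕ∞) + 1 := by norm_num
    rw [h2, contDiff_succ_iff_hasFDerivAt]
    exact ⟨_, ContDiff.sum fun i _ => (hdiff i).smul contDiff_const,
      hasFDerivAt_of_continuous_partials (fun i => (h i).1) fun i => (h i).2.2⟩
  · obtain ⟨K₁, hK₁⟩ := h.exists_norm_fderiv_le
    choose K hK using fun i => (hG i).exists_norm_fderiv_le
    refine ⟨max K₁ (∑ i, K i), fun z => ⟨(hK₁ z).trans (le_max_left _ _), ?_⟩⟩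
    refine le_trans ?_ (le_max_right _ _)
    rw [h.fderiv_eq]
    have hd : HasFDerivAt
        (fun z => ∑ i, G i z • ContinuousLinearMap.proj (R := ℝ) (φ := fun _ : ι => ℝ) i)
        (∑ i, (fderiv ℝ (G i) z).smulRight
          (ContinuousLinearMap.proj (R := ℝ) (φ := fun _ : ι => ℝ) i)) z :=
      HasFDerivAt.fun_sum fun i _ => by
        have hi := (((hdiff i).differentiable one_ne_zero) z).hasFDerivAt
        exact hi.smul_const (ContinuousLinearMap.proj (R := ℝ) (φ := fun _ : ι => ℝ) i)
    rw [hd.fderiv]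
    refine (norm_sum_le Finset.univ fun i => (fderiv ℝ (G i) z).smulRight
      (ContinuousLinearMap.proj (R := ℝ) (φ := fun _ : ι => ℝ) i)).trans
      (Finset.sum_le_sum fun i _ => ?_)
    have hn := ContinuousLinearMap.norm_smulRight_apply (fderiv ℝ (G i) z)
      (ContinuousLinearMap.proj (R := ℝ) (φ := fun _ : ι => ℝ) i)
    refine hn.le.trans ?_
    exact (mul_le_of_le_one_right (norm_nonneg _) (norm_pi_proj_le_one i)).trans (hK i z)

end PartialDerivatives

section Integration

/-- Inserting one coordinate into a vector of coordinates preserves Lebesgue measure. -/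
theorem measurePreserving_insert_coordinate {κ κ' : Type*} [Fintype κ] [Fintype κ']
    {φ : ℝ × (κ' → ℝ) → κ → ℝ} {a : κ} {c : κ' → κ}
    (hb : Function.Bijective fun o : Option κ' => o.elim a c)
    (ha : ∀ s y, φ (s, y) a = s) (hc : ∀ s y k, φ (s, y) (c k) = y k) :
    MeasurePreserving φ volume volume := by
  have hmeas : Measurable φ := by
    refine measurable_pi_iff.2 fun k => ?_
    obtain ⟨o, rfl⟩ := hb.2 k
    cases o with
    | none => simpa only [Option.elim_none, ha] using measurable_fst
    | some k =>
      have : Measurable fun p : ℝ × (κ' → ℝ) => p.2 k := by fun_prop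
      simpa only [Option.elim_some, hc] using this
  refine ⟨hmeas, ?_⟩
  refine (Measure.pi_eq fun s hs => ?_).symm
  rw [Measure.map_apply hmeas (MeasurableSet.univ_pi hs)]
  have hpre : φ ⁻¹' Set.univ.pi s = s a ×ˢ Set.univ.pi fun k => s (c k) := by
    ext ⟨t, y⟩
    simp only [Set.mem_preimage, Set.mem_univ_pi, Set.mem_prod]
    constructor
    · intro h
      exact ⟨ha t y ▸ h a, fun k => hc t y k ▸ h (c k)⟩
    · rintro ⟨h1, h2⟩ k
      obtain ⟨o, rfl⟩ := hb.2 k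
      cases o with
      | none => exact (ha t y).symm ▸ h1
      | some k => exact (hc t y k).symm ▸ h2 k
  rw [hpre, Measure.volume_eq_prod, Measure.prod_prod, volume_pi_pi,
    ← (Equiv.ofBijective _ hb).prod_comp fun k => volume (s k), Fintype.prod_option]
  rfl

/-- The derivative of an integral over a half space with respect to the position of the
bounding hyperplane is the integral over that hyperplane. -/
theorem hasDerivAt_setIntegral_of_measurePreserving {X Y : Type*} [MeasureSpace X]
    [MeasureSpace Y] [SigmaFinite (volume : Measure Y)] {φ : ℝ × Y → X}
    (hφ : MeasurePreserving φ volume volume) {g : X → ℝ} (hg : Integrable g)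
    {A : ℝ → Set X} (hA : ∀ t, MeasurableSet (A t)) {B : Set Y}
    (hAB : ∀ t s y, φ (s, y) ∈ A t ↔ s ≤ t ∧ y ∈ B)
    (hcont : Continuous fun s => ∫ y in B, g (φ (s, y))) (t : ℝ) :
    HasDerivAt (fun t => ∫ x in A t, g x) (∫ y in B, g (φ (t, y))) t := by
  set h : ℝ → ℝ := fun s => ∫ y in B, g (φ (s, y)) with hh
  have hgφ : Integrable (g ∘ φ) (volume.prod volume) := hφ.integrable_comp_of_integrable hg
  have hint : Integrable h := by
    have : Integrable (g ∘ φ) ((volume : Measure ℝ).prod ((volume : Measure Y).restrict B)) := by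
      rw [← Measure.restrict_univ (μ := (volume : Measure ℝ)), Measure.prod_restrict]
      exact hgφ.restrict
    exact this.integral_prod_left
  have heq : ∀ t, ∫ x in A t, g x = ∫ s in Set.Iic t, h s := by
    intro t
    have hpre : φ ⁻¹' A t = Set.Iic t ×ˢ B := by
      ext ⟨s, y⟩
      exact hAB t s y
    have h1 : ∫ x in A t, g x = ∫ x in A t, g x ∂(volume.map φ) := by rw [hφ.map_eq]
    rw [h1, setIntegral_map (hA t) (by rw [hφ.map_eq]; exact hg.aestronglyMeasurable)
      hφ.measurable.aemeasurable, hpre, Measure.volume_eq_prod]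
    exact setIntegral_prod _ hgφ.integrableOn
  have heq' : (fun t => ∫ x in A t, g x)
      = fun u => (∫ s in Set.Iic t, h s) + ∫ s in t..u, h s := by
    funext u
    rw [heq, ← intervalIntegral.integral_Iic_sub_Iic hint.integrableOn hint.integrableOn]
    ring
  rw [heq']
  exact (intervalIntegral.integral_hasDerivAt_right (hint.intervalIntegrable)
    (hcont.stronglyMeasurableAtFilter _ _) hcont.continuousAt).const_add _

variable {d : ℕ} {κ : Type*} [Fintype κ] {c : κ → Fin d} {I : Finset (Fin d)}

/-- The points all of whose coordinates labelled by an element of `I` are at most the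
corresponding coordinate of `z`. -/
def lowerBox (c : κ → Fin d) (I : Finset (Fin d)) (z : {i : Fin d // i ∈ I} → ℝ) :
    Set (κ → ℝ) :=
  {y | ∀ k (h : c k ∈ I), y k ≤ z ⟨c k, h⟩}

theorem measurableSet_lowerBox (z : {i : Fin d // i ∈ I} → ℝ) :
    MeasurableSet (lowerBox c I z) := by
  have : lowerBox c I z = ⋂ k, ⋂ h : c k ∈ I, {y | y k ≤ z ⟨c k, h⟩} := by
    ext y; simp [lowerBox]
  rw [this]
  exact MeasurableSet.iInter fun k => MeasurableSet.iInter fun h =>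
    measurableSet_le (measurable_pi_apply k) measurable_const

theorem continuous_setIntegral_lowerBox {g : (κ → ℝ) → ℝ} (hg : Integrable g) :
    Continuous fun z => ∫ y in lowerBox c I z, g y := by
  simp_rw [← integral_indicator (measurableSet_lowerBox _)]
  refine continuous_iff_continuousAt.2 fun z₀ => ?_
  refine tendsto_integral_filter_of_dominated_convergence (fun y => ‖g y‖)
    (Eventually.of_forall fun z =>
      (hg.indicator (measurableSet_lowerBox z)).aestronglyMeasurable)
    (Eventually.of_forall fun z => Eventually.of_forall fun y => norm_indicator_le_norm_self g y)
    hg.norm ?_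
  have hae : ∀ᵐ y : κ → ℝ, ∀ k (h : c k ∈ I), y k ≠ z₀ ⟨c k, h⟩ :=
    ae_all_iff.2 fun k => ae_all_iff.2 fun h =>
      Measure.ae_eval_ne (μ := fun _ : κ => (volume : Measure ℝ)) k _
  filter_upwards [hae] with y hy
  have hev : ∀ᶠ z in 𝓝 z₀, ∀ k (h : c k ∈ I), (y k ≤ z ⟨c k, h⟩ ↔ y k ≤ z₀ ⟨c k, h⟩) := by
    refine eventually_all.2 fun k => eventually_all.2 fun h => ?_
    have hz : Tendsto (fun z : {i : Fin d // i ∈ I} → ℝ => z ⟨c k, h⟩) (𝓝 z₀)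
        (𝓝 (z₀ ⟨c k, h⟩)) := (continuous_apply _).tendsto _
    rcases lt_or_gt_of_ne (hy k h) with hlt | hgt
    · filter_upwards [hz.eventually_const_lt hlt] with z hz
      exact ⟨fun _ => hlt.le, fun _ => hz.le⟩
    · filter_upwards [hz.eventually_lt_const hgt] with z hz
      exact ⟨fun h => absurd h hz.not_ge, fun h => absurd h hgt.not_ge⟩
  refine tendsto_const_nhds.congr' ?_
  filter_upwards [hev] with z hz
  have hmem : y ∈ lowerBox c I z ↔ y ∈ lowerBox c I z₀ :=
    forall_congr' fun k => forall_congr' fun h => hz k h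
  by_cases hy' : y ∈ lowerBox c I z₀
  · rw [Set.indicator_of_mem hy', Set.indicator_of_mem (hmem.2 hy')]
  · rw [Set.indicator_of_notMem hy', Set.indicator_of_notMem (mt hmem.1 hy')]

/-- Integrals over lower boxes depend jointly continuously on the corner of the box and on a
parameter on which the integrand depends continuously in `L¹`. -/
theorem continuous_setIntegral_lowerBox_of_L1 {T : Type*} [TopologicalSpace T]
    {G : T → (κ → ℝ) → ℝ} (hint : ∀ t, Integrable (G t))
    (hL1 : ∀ t₀, Tendsto (fun t => ∫⁻ y, ‖G t y - G t₀ y‖ₑ) (𝓝 t₀) (𝓝 0)) :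
    Continuous fun p : T × ({i : Fin d // i ∈ I} → ℝ) => ∫ y in lowerBox c I p.2, G p.1 y := by
  refine continuous_iff_continuousAt.2 fun ⟨t₀, z₀⟩ => ?_
  have h1 : Tendsto (fun p : T × ({i : Fin d // i ∈ I} → ℝ) =>
      ∫ y in lowerBox c I p.2, (G p.1 y - G t₀ y)) (𝓝 (t₀, z₀)) (𝓝 0) := by
    rw [tendsto_zero_iff_enorm_tendsto_zero]
    refine tendsto_of_tendsto_of_tendsto_of_le_of_le tendsto_const_nhds
      ((hL1 t₀).comp (continuous_fst.tendsto (t₀, z₀))) (fun _ => zero_le) fun p => ?_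
    exact (enorm_integral_le_lintegral_enorm _).trans (setLIntegral_le_lintegral _ _)
  have h2 := ((continuous_setIntegral_lowerBox (c := c) (I := I) (hint t₀)).comp
    continuous_snd).tendsto (t₀, z₀)
  have h3 := h1.add h2
  rw [zero_add] at h3
  refine h3.congr fun p => ?_
  rw [integral_sub (hint _).restrict (hint _).restrict]
  simp

/-- Dominated convergence in `L¹`, with a majorant which need not be measurable. -/
theorem tendsto_lintegral_enorm_sub_of_dominated {X ι : Type*} [MeasurableSpace X]
    {μ : Measure X} {l : Filter ι} [l.IsCountablyGenerated] {F : ι → X → ℝ} {f : X → ℝ}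
    {M : X → ℝ} (hF : ∀ i, Measurable (F i)) (hf : Measurable f)
    (hM : ∫⁻ x, ENNReal.ofReal (M x) ∂μ < ⊤) (hFM : ∀ᶠ i in l, ∀ x, |F i x| ≤ M x)
    (hfM : ∀ x, |f x| ≤ M x) (hlim : ∀ x, Tendsto (fun i => F i x) l (𝓝 (f x))) :
    Tendsto (fun i => ∫⁻ x, ‖F i x - f x‖ₑ ∂μ) l (𝓝 0) := by
  have h0 : ∫⁻ _x, (0 : ENNReal) ∂μ = 0 := lintegral_zero
  rw [← h0]
  refine tendsto_lintegral_filter_of_dominated_convergence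
    (fun x => 2 * ENNReal.ofReal (M x))
    (Eventually.of_forall fun i => ((hF i).sub hf).enorm) ?_ ?_ ?_
  · filter_upwards [hFM] with i hi
    refine Eventually.of_forall fun x => ?_
    refine enorm_sub_le.trans ?_
    rw [two_mul, Real.enorm_eq_ofReal_abs, Real.enorm_eq_ofReal_abs]
    gcongr
    · exact hi x
    · exact hfM x
  · rw [lintegral_const_mul' _ _ (by simp)]
    exact ENNReal.mul_ne_top (by simp) hM.ne
  · refine Eventually.of_forall fun x => ?_
    have := ((hlim x).sub_const (f x)).enorm
    simpa using this

theorem integrable_of_lintegral_le_ofReal {X : Type*} [MeasurableSpace X] {μ : Measure X}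
    {g : X → ℝ} (hg : AEStronglyMeasurable g μ) {K : ℝ}
    (hK : ∫⁻ x, ENNReal.ofReal |g x| ∂μ ≤ ENNReal.ofReal K) : Integrable g μ := by
  refine ⟨hg, ?_⟩
  simp_rw [← Real.enorm_eq_ofReal_abs] at hK
  exact hK.trans_lt ENNReal.ofReal_lt_top

theorem abs_setIntegral_le_of_lintegral_le {X : Type*} [MeasurableSpace X] {μ : Measure X}
    {g : X → ℝ} {K : ℝ} (hK : ∫⁻ x, ENNReal.ofReal |g x| ∂μ ≤ ENNReal.ofReal K) (B : Set X) :
    |∫ x in B, g x ∂μ| ≤ max K 0 := by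
  have h1 : ‖∫ x in B, g x ∂μ‖ₑ ≤ ENNReal.ofReal K := by
    refine (enorm_integral_le_lintegral_enorm _).trans ?_
    refine (setLIntegral_le_lintegral _ _).trans ?_
    simpa only [Real.enorm_eq_ofReal_abs] using hK
  rw [Real.enorm_eq_ofReal_abs] at h1
  rw [← ENNReal.ofReal_le_ofReal_iff (le_max_right _ _)]
  exact h1.trans (ENNReal.ofReal_le_ofReal (le_max_left _ _))

end Integration

section Coordinates

variable {d : ℕ} {f : (Fin d → ℝ) → ℝ}

theorem update_fill1 (j : Fin d) (t s : ℝ) (y : {k : Fin d // k ≠ j} → ℝ) :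
    Function.update (fill1 j t y) j s = fill1 j s y := by
  funext k
  by_cases h : k = j
  · subst h; simp [fill1]
  · simp [fill1, h]

theorem fill1_fillSub_eq_fill2 {i j : Fin d} (hij : i ≠ j) (u v : ℝ)
    (z : {k : Fin d // k ≠ i ∧ k ≠ j} → ℝ) :
    fill1 j v (fillSub j i u z) = fill2 i j u v z := by
  funext k
  by_cases hj : k = j
  · subst hj; simp [fill1, fill2, hij.symm]
  · by_cases hi : k = i
    · subst hi; simp [fill1, fill2, fillSub, hij]
    · simp [fill1, fill2, fillSub, hi, hj]

theorem continuous_fill1 (j : Fin d) :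
    Continuous fun p : ℝ × ({k : Fin d // k ≠ j} → ℝ) => fill1 j p.1 p.2 := by
  refine continuous_pi fun k => ?_
  by_cases h : k = j
  · simpa [fill1, h] using continuous_fst
  · simp only [fill1, h, dite_false]
    fun_prop

theorem continuous_fillSub (j i : Fin d) (s : ℝ) :
    Continuous fun z : {k : Fin d // k ≠ i ∧ k ≠ j} → ℝ => fillSub j i s z := by
  refine continuous_pi fun k => ?_
  by_cases h : k.1 = i
  · simpa [fillSub, h] using continuous_const
  · simp only [fillSub, h, dite_false]
    fun_prop

theorem continuous_comp_fill1 (hf : Continuous f) (j : Fin d) (t : ℝ) :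
    Continuous fun y => f (fill1 j t y) :=
  hf.comp ((continuous_fill1 j).comp (Continuous.prodMk_right t))

theorem continuous_comp_fill1_fillSub (hf : Continuous f) (i j : Fin d) (u v : ℝ) :
    Continuous fun z => f (fill1 j v (fillSub j i u z)) :=
  (continuous_comp_fill1 hf j v).comp (continuous_fillSub j i u)

theorem bijective_elim_val (j : Fin d) :
    Function.Bijective fun o : Option {k : Fin d // k ≠ j} => o.elim j Subtype.val := by
  constructor
  · rintro (_ | a) (_ | b) h
    · rfl
    · exact absurd h.symm b.2
    · exact absurd h a.2
    · exact congrArg some (Subtype.ext h)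
  · intro k
    by_cases h : k = j
    · exact ⟨none, h.symm⟩
    · exact ⟨some ⟨k, h⟩, rfl⟩

theorem bijective_elim_pair {i j : Fin d} (hij : i ≠ j) :
    Function.Bijective fun o : Option {k : Fin d // k ≠ i ∧ k ≠ j} =>
      o.elim (⟨i, hij⟩ : {k : Fin d // k ≠ j}) fun k => ⟨k.1, k.2.2⟩ := by
  constructor
  · rintro (_ | a) (_ | b) h
    · rfl
    · exact absurd (congrArg Subtype.val h).symm b.2.1
    · exact absurd (congrArg Subtype.val h) a.2.1
    · exact congrArg some (Subtype.ext (Subtype.mk.inj h))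
  · rintro ⟨k, hk⟩
    by_cases h : k = i
    · subst h; exact ⟨none, rfl⟩
    · exact ⟨some ⟨k, h, hk⟩, rfl⟩

theorem fill1_self (j : Fin d) (s : ℝ) (y : {k : Fin d // k ≠ j} → ℝ) : fill1 j s y j = s := by
  simp [fill1]

theorem fill1_val (j : Fin d) (s : ℝ) (y : {k : Fin d // k ≠ j} → ℝ)
    (k : {k : Fin d // k ≠ j}) : fill1 j s y k.1 = y k := by
  simp [fill1, k.2]

theorem fillSub_self {i j : Fin d} (hij : i ≠ j) (s : ℝ)
    (z : {k : Fin d // k ≠ i ∧ k ≠ j} → ℝ) : fillSub j i s z ⟨i, hij⟩ = s := by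
  simp [fillSub]

theorem fillSub_val (i j : Fin d) (s : ℝ) (z : {k : Fin d // k ≠ i ∧ k ≠ j} → ℝ)
    (k : {k : Fin d // k ≠ i ∧ k ≠ j}) : fillSub j i s z ⟨k.1, k.2.2⟩ = z k := by
  simp [fillSub, k.2.1]

theorem measurePreserving_fill1 (j : Fin d) :
    MeasurePreserving (fun p : ℝ × ({k : Fin d // k ≠ j} → ℝ) => fill1 j p.1 p.2) volume volume :=
  measurePreserving_insert_coordinate (bijective_elim_val j) (fill1_self j) (fill1_val j)

theorem measurePreserving_fillSub {i j : Fin d} (hij : i ≠ j) :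
    MeasurePreserving (fun p : ℝ × ({k : Fin d // k ≠ i ∧ k ≠ j} → ℝ) => fillSub j i p.1 p.2)
      volume volume :=
  measurePreserving_insert_coordinate (bijective_elim_pair hij) (fillSub_self hij)
    (fillSub_val i j)

theorem mem_lowerBox_update_iff {κ κ' : Type*} {I : Finset (Fin d)} {c₀ : κ → Fin d}
    (hinj : Function.Injective c₀) {a : κ} {c : κ' → κ}
    (hb : Function.Bijective fun o : Option κ' => o.elim a c) {x : κ → ℝ} {s : ℝ} {y : κ' → ℝ}
    (ha : x a = s) (hc : ∀ k, x (c k) = y k) (i : {i : Fin d // i ∈ I}) (hi : c₀ a = i.1)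
    (z : {i : Fin d // i ∈ I} → ℝ) (t : ℝ) :
    x ∈ lowerBox c₀ I (Function.update z i t) ↔ s ≤ t ∧ y ∈ lowerBox (fun k => c₀ (c k)) I z := by
  have hne : ∀ k, c k ≠ a := fun k h => by simpa using hb.1 (a₁ := some k) (a₂ := none) h
  have hup : ∀ k (h : c₀ (c k) ∈ I), Function.update z i t ⟨c₀ (c k), h⟩ = z ⟨c₀ (c k), h⟩ := by
    intro k h
    refine Function.update_of_ne (fun he => hne k (hinj ?_)) _ _
    rw [hi, ← he]
  constructor
  · intro h
    refine ⟨?_, fun k hk => ?_⟩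
    · have := h a (hi ▸ i.2)
      have he : (⟨c₀ a, hi ▸ i.2⟩ : {i : Fin d // i ∈ I}) = i := Subtype.ext hi
      rwa [ha, he, Function.update_self] at this
    · have := h (c k) hk
      rwa [hc, hup] at this
  · rintro ⟨h1, h2⟩ k hk
    obtain ⟨o, rfl⟩ := hb.2 k
    cases o with
    | none =>
      have he : (⟨c₀ a, hk⟩ : {i : Fin d // i ∈ I}) = i := Subtype.ext hi
      simpa only [Option.elim_none, ha, he, Function.update_self] using h1
    | some k => exact (hc k).le.trans ((h2 k hk).trans_eq (hup k hk).symm)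

theorem lowerBox_val_update {I : Finset (Fin d)} (i : {i : Fin d // i ∈ I})
    (z : {i : Fin d // i ∈ I} → ℝ) (t : ℝ) :
    lowerBox (Subtype.val : {k : Fin d // k ≠ i.1} → Fin d) I (Function.update z i t)
      = lowerBox Subtype.val I z := by
  have hup : ∀ (k : {k : Fin d // k ≠ i.1}) (h : k.1 ∈ I),
      Function.update z i t ⟨k.1, h⟩ = z ⟨k.1, h⟩ := fun k h =>
    Function.update_of_ne (fun he => k.2 (congrArg Subtype.val he)) _ _
  ext y
  simp only [lowerBox, Set.mem_ofPred_eq, hup]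

theorem cdfI_eq_setIntegral_lowerBox (I : Finset (Fin d)) (z : {i : Fin d // i ∈ I} → ℝ) :
    cdfI d f I z = ∫ y in lowerBox id I z, f y := by
  have : {y : Fin d → ℝ | ∀ i : {i : Fin d // i ∈ I}, y i.1 ≤ z i} = lowerBox id I z := by
    ext y
    exact ⟨fun h k hk => h ⟨k, hk⟩, fun h i => h i.1 i.2⟩
  rw [cdfI, this]

theorem lintegral_comp_fillSub_swap (i j : Fin d)
    (g : ({k : Fin d // k ≠ j ∧ k ≠ i} → ℝ) → ENNReal) :
    ∫⁻ z, g z = ∫⁻ z : {k : Fin d // k ≠ i ∧ k ≠ j} → ℝ, g fun k => z ⟨k.1, k.2.symm⟩ := by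
  have hmp := volume_measurePreserving_piCongrLeft (fun _ : {k : Fin d // k ≠ j ∧ k ≠ i} => ℝ)
    (Equiv.subtypeEquivRight fun k : Fin d => and_comm (a := k ≠ i) (b := k ≠ j))
  rw [hmp.lintegral_map_equiv]
  rfl

theorem fill1_fillSub_swap {i j : Fin d} (hij : i ≠ j) (u v : ℝ)
    (z : {k : Fin d // k ≠ i ∧ k ≠ j} → ℝ) :
    fill1 i u (fillSub i j v fun k => z ⟨k.1, k.2.symm⟩) = fill1 j v (fillSub j i u z) := by
  funext k
  by_cases hj : k = j
  · subst hj; simp [fill1, fillSub, hij.symm]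
  · by_cases hi : k = i
    · subst hi; simp [fill1, fillSub, hij]
    · simp [fill1, fillSub, hi, hj]

end Coordinates

section Density

variable {d : ℕ} {f : (Fin d → ℝ) → ℝ}

/-- The partial derivatives of `f` are majorized, locally uniformly in the differentiation
variable, by integrable functions of the other variables whose marginals are locally bounded. -/
def LocallyMajorized (f : (Fin d → ℝ) → ℝ) : Prop :=
  ∀ (a : ℝ) (j : Fin d), ∃ ε > (0 : ℝ),
    ∃ M : ({k : Fin d // k ≠ j} → ℝ) → ℝ,
      (∀ y, 0 ≤ M y) ∧
      (∫⁻ y : {k : Fin d // k ≠ j} → ℝ, ENNReal.ofReal (M y)) < ⊤ ∧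
      (∀ t : ℝ, |t - a| ≤ ε → ∀ y : {k : Fin d // k ≠ j} → ℝ,
        |deriv (fun u => f (fill1 j u y)) t| ≤ M y) ∧
      (∀ i : Fin d, i ≠ j → ∀ r : ℝ, 0 < r → ∃ K : ℝ, ∀ u : ℝ, |u| ≤ r →
        ∫⁻ z : {k : Fin d // k ≠ i ∧ k ≠ j} → ℝ,
          ENNReal.ofReal (M (fillSub j i u z)) ≤ ENNReal.ofReal K)

theorem hasDerivAt_comp_fill1
    (hdiff : ∀ (j : Fin d) (x : Fin d → ℝ),
      DifferentiableAt ℝ (fun t => f (Function.update x j t)) (x j))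
    (j : Fin d) (y : {k : Fin d // k ≠ j} → ℝ) (t : ℝ) :
    HasDerivAt (fun u => f (fill1 j u y)) (deriv (fun u => f (fill1 j u y)) t) t := by
  have := hdiff j (fill1 j t y)
  simp only [update_fill1, fill1_self] at this
  exact this.hasDerivAt

theorem measurable_deriv_comp_fill1 (hcont : Continuous f) (j : Fin d) (t : ℝ) :
    Measurable fun y => deriv (fun u => f (fill1 j u y)) t := by
  have h : Continuous (Function.uncurry fun (y : {k : Fin d // k ≠ j} → ℝ) (u : ℝ) =>
      f (fill1 j u y)) := hcont.comp ((continuous_fill1 j).comp continuous_swap)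
  exact (measurable_deriv_with_param h).comp (measurable_prodMk_right (y := t))

theorem abs_sub_le_of_abs_deriv_le
    (hdiff : ∀ (j : Fin d) (x : Fin d → ℝ),
      DifferentiableAt ℝ (fun t => f (Function.update x j t)) (x j))
    {j : Fin d} {y : {k : Fin d // k ≠ j} → ℝ} {a ε C : ℝ}
    (hC : ∀ t, |t - a| ≤ ε → |deriv (fun u => f (fill1 j u y)) t| ≤ C) {t : ℝ}
    (ht : |t - a| ≤ ε) : |f (fill1 j t y) - f (fill1 j a y)| ≤ C * |t - a| :=
  (convex_closedBall a ε).norm_image_sub_le_of_norm_hasDerivWithin_le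
    (fun s _ => (hasDerivAt_comp_fill1 hdiff j y s).hasDerivWithinAt)
    (fun s hs => hC s (by simpa [Real.dist_eq] using hs))
    (Metric.mem_closedBall_self ((abs_nonneg _).trans ht))
    (by simpa [Real.dist_eq] using ht)

theorem enorm_sub_le_of_abs_deriv_le
    (hdiff : ∀ (j : Fin d) (x : Fin d → ℝ),
      DifferentiableAt ℝ (fun t => f (Function.update x j t)) (x j))
    {j : Fin d} {y : {k : Fin d // k ≠ j} → ℝ} {a ε C : ℝ}
    (hC : ∀ t, |t - a| ≤ ε → |deriv (fun u => f (fill1 j u y)) t| ≤ C) {t : ℝ}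
    (ht : |t - a| ≤ ε) :
    ‖f (fill1 j t y) - f (fill1 j a y)‖ₑ ≤ ENNReal.ofReal |t - a| * ENNReal.ofReal C := by
  rw [← ENNReal.ofReal_mul (abs_nonneg _), Real.enorm_eq_ofReal_abs, mul_comm]
  exact ENNReal.ofReal_le_ofReal (abs_sub_le_of_abs_deriv_le hdiff hC ht)

theorem tendsto_ofReal_abs_sub_mul {C : ENNReal} (hC : C ≠ ⊤) (a : ℝ) :
    Tendsto (fun t => ENNReal.ofReal |t - a| * C) (𝓝 a) (𝓝 0) := by
  have h : Tendsto (fun t => ENNReal.ofReal |t - a|) (𝓝 a) (𝓝 0) := by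
    have : Continuous fun t : ℝ => ENNReal.ofReal |t - a| :=
      ENNReal.continuous_ofReal.comp (by fun_prop)
    simpa using this.tendsto a
  simpa using ENNReal.Tendsto.mul_const h (Or.inr hC)

theorem eventually_abs_sub_le {ε : ℝ} (hε : 0 < ε) (a : ℝ) : ∀ᶠ t in 𝓝 a, |t - a| ≤ ε := by
  filter_upwards [Metric.closedBall_mem_nhds a hε] with t ht
  simpa [Real.dist_eq] using ht

theorem tendsto_lintegral_enorm_fill1_sub
    (hdiff : ∀ (j : Fin d) (x : Fin d → ℝ),
      DifferentiableAt ℝ (fun t => f (Function.update x j t)) (x j))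
    (hmaj : LocallyMajorized f) (j : Fin d) (a : ℝ) :
    Tendsto (fun t => ∫⁻ y, ‖f (fill1 j t y) - f (fill1 j a y)‖ₑ) (𝓝 a) (𝓝 0) := by
  obtain ⟨ε, hε, M, -, hMint, hMd, -⟩ := hmaj a j
  refine tendsto_of_tendsto_of_tendsto_of_le_of_le' tendsto_const_nhds
    (tendsto_ofReal_abs_sub_mul hMint.ne a) (Eventually.of_forall fun _ => zero_le) ?_
  filter_upwards [eventually_abs_sub_le hε a] with t ht
  rw [← lintegral_const_mul' _ _ ENNReal.ofReal_ne_top]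
  exact lintegral_mono fun y =>
    enorm_sub_le_of_abs_deriv_le hdiff (fun s hs => hMd s hs y) ht

theorem exists_lintegral_enorm_fill1_fillSub_sub_le
    (hdiff : ∀ (j : Fin d) (x : Fin d → ℝ),
      DifferentiableAt ℝ (fun t => f (Function.update x j t)) (x j))
    (hmaj : LocallyMajorized f) {i j : Fin d} (hij : i ≠ j) (a : ℝ) {r : ℝ} (hr : 0 < r) :
    ∃ ε > (0 : ℝ), ∃ K : ℝ, ∀ t, |t - a| ≤ ε → ∀ u, |u| ≤ r →
      ∫⁻ z, ‖f (fill1 j t (fillSub j i u z)) - f (fill1 j a (fillSub j i u z))‖ₑ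
        ≤ ENNReal.ofReal |t - a| * ENNReal.ofReal K := by
  obtain ⟨ε, hε, M, -, -, hMd, hMs⟩ := hmaj a j
  obtain ⟨K, hK⟩ := hMs i hij r hr
  refine ⟨ε, hε, K, fun t ht u hu => ?_⟩
  refine le_trans ?_ (mul_le_mul_right (hK u hu) _)
  rw [← lintegral_const_mul' _ _ ENNReal.ofReal_ne_top]
  exact lintegral_mono fun z =>
    enorm_sub_le_of_abs_deriv_le hdiff (fun s hs => hMd s hs _) ht

theorem tendsto_lintegral_enorm_fill1_fillSub_sub (hcont : Continuous f)
    (hdiff : ∀ (j : Fin d) (x : Fin d → ℝ),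
      DifferentiableAt ℝ (fun t => f (Function.update x j t)) (x j))
    (hmaj : LocallyMajorized f) {i j : Fin d} (hij : i ≠ j) (p₀ : ℝ × ℝ) :
    Tendsto (fun p : ℝ × ℝ => ∫⁻ z, ‖f (fill1 j p.1 (fillSub j i p.2 z))
      - f (fill1 j p₀.1 (fillSub j i p₀.2 z))‖ₑ) (𝓝 p₀) (𝓝 0) := by
  obtain ⟨t₀, u₀⟩ := p₀
  have hr : 0 < |u₀| + 1 := by positivity
  have hr' : |t₀| < |t₀| + 1 := lt_add_one _
  obtain ⟨ε₁, hε₁, K₁, h₁⟩ :=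
    exists_lintegral_enorm_fill1_fillSub_sub_le hdiff hmaj hij t₀ hr
  obtain ⟨ε₂, hε₂, K₂, h₂⟩ := exists_lintegral_enorm_fill1_fillSub_sub_le hdiff hmaj hij.symm u₀
    ((abs_nonneg t₀).trans_lt hr')
  have hlim := ((tendsto_ofReal_abs_sub_mul (C := ENNReal.ofReal K₁) ENNReal.ofReal_ne_top
    t₀).comp (continuous_fst.tendsto (t₀, u₀))).add
    ((tendsto_ofReal_abs_sub_mul (C := ENNReal.ofReal K₂) ENNReal.ofReal_ne_top u₀).comp
      (continuous_snd.tendsto (t₀, u₀)))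
  rw [add_zero] at hlim
  refine tendsto_of_tendsto_of_tendsto_of_le_of_le' tendsto_const_nhds hlim
    (Eventually.of_forall fun _ => zero_le) ?_
  have hu : ∀ᶠ p : ℝ × ℝ in 𝓝 (t₀, u₀), |p.2| ≤ |u₀| + 1 := by
    have : Continuous fun p : ℝ × ℝ => |p.2| := by fun_prop
    exact ((this.tendsto (t₀, u₀)).eventually_lt_const (lt_add_one _)).mono fun _ h => h.le
  filter_upwards [(continuous_fst.tendsto (t₀, u₀)).eventually (eventually_abs_sub_le hε₁ t₀),
    (continuous_snd.tendsto (t₀, u₀)).eventually (eventually_abs_sub_le hε₂ u₀), hu]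
    with p hp1 hp2 hp3
  have hc := continuous_comp_fill1_fillSub hcont i j
  calc ∫⁻ z, ‖f (fill1 j p.1 (fillSub j i p.2 z)) - f (fill1 j t₀ (fillSub j i u₀ z))‖ₑ
      ≤ ∫⁻ z, (‖f (fill1 j p.1 (fillSub j i p.2 z)) - f (fill1 j t₀ (fillSub j i p.2 z))‖ₑ
        + ‖f (fill1 j t₀ (fillSub j i p.2 z)) - f (fill1 j t₀ (fillSub j i u₀ z))‖ₑ) :=
        lintegral_mono fun z => by
          simpa using enorm_add_le
            (f (fill1 j p.1 (fillSub j i p.2 z)) - f (fill1 j t₀ (fillSub j i p.2 z)))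
            (f (fill1 j t₀ (fillSub j i p.2 z)) - f (fill1 j t₀ (fillSub j i u₀ z)))
    _ = (∫⁻ z, ‖f (fill1 j p.1 (fillSub j i p.2 z)) - f (fill1 j t₀ (fillSub j i p.2 z))‖ₑ)
        + ∫⁻ z, ‖f (fill1 j t₀ (fillSub j i p.2 z)) - f (fill1 j t₀ (fillSub j i u₀ z))‖ₑ :=
        lintegral_add_left ((hc _ _).sub (hc _ _)).measurable.enorm _
    _ ≤ _ := by
        refine add_le_add (h₁ _ hp1 _ hp3) ?_
        refine le_trans (le_of_eq ?_) (h₂ p.2 hp2 t₀ hr'.le)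
        rw [lintegral_comp_fillSub_swap i j]
        simp only [fill1_fillSub_swap hij]

theorem tendsto_lintegral_enorm_deriv_sub (hcont : Continuous f)
    (hpdcont : ∀ (j : Fin d) (y : {k : Fin d // k ≠ j} → ℝ),
      Continuous (fun t : ℝ => deriv (fun u => f (fill1 j u y)) t))
    (hmaj : LocallyMajorized f) (j : Fin d) (a : ℝ) :
    Tendsto (fun t => ∫⁻ y, ‖deriv (fun u => f (fill1 j u y)) t
      - deriv (fun u => f (fill1 j u y)) a‖ₑ) (𝓝 a) (𝓝 0) := by
  obtain ⟨ε, hε, M, -, hMint, hMd, -⟩ := hmaj a j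
  refine tendsto_lintegral_enorm_sub_of_dominated (measurable_deriv_comp_fill1 hcont j)
    (measurable_deriv_comp_fill1 hcont j a) hMint ?_ (hMd a (by simpa using hε.le))
    fun y => (hpdcont j y).tendsto a
  filter_upwards [eventually_abs_sub_le hε a] with t ht using hMd t ht

/-- Differentiation under the integral sign in the variable `x_j`. -/
theorem hasDerivAt_setIntegral_fill1 (hcont : Continuous f)
    (hdiff : ∀ (j : Fin d) (x : Fin d → ℝ),
      DifferentiableAt ℝ (fun t => f (Function.update x j t)) (x j))
    (hmaj : LocallyMajorized f) {j : Fin d} (hint : ∀ t, Integrable fun y => f (fill1 j t y))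
    (B : Set ({k : Fin d // k ≠ j} → ℝ)) (a : ℝ) :
    HasDerivAt (fun t => ∫ y in B, f (fill1 j t y))
      (∫ y in B, deriv (fun u => f (fill1 j u y)) a) a := by
  obtain ⟨ε, hε, M, -, hMint, hMd, -⟩ := hmaj a j
  rw [hasDerivAt_iff_tendsto_slope]
  have hlim : Tendsto (fun t => ∫⁻ y, ‖slope (fun u => f (fill1 j u y)) a t
      - deriv (fun u => f (fill1 j u y)) a‖ₑ) (𝓝[≠] a) (𝓝 0) := by
    refine tendsto_lintegral_enorm_sub_of_dominated (fun t => ?_)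
      (measurable_deriv_comp_fill1 hcont j a) hMint ?_ (hMd a (by simpa using hε.le)) fun y =>
        hasDerivAt_iff_tendsto_slope.1 (hasDerivAt_comp_fill1 hdiff j y a)
    · simp only [slope_def_field]
      exact (((continuous_comp_fill1 hcont j t).sub
        (continuous_comp_fill1 hcont j a)).div_const _).measurable
    · filter_upwards [nhdsWithin_le_nhds (eventually_abs_sub_le hε a), self_mem_nhdsWithin]
        with t ht hta y
      rw [slope_def_field, abs_div, div_le_iff₀ (abs_pos.2 (sub_ne_zero.2 hta))]
      exact abs_sub_le_of_abs_deriv_le hdiff (fun s hs => hMd s hs y) ht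
  have hslope : ∀ t, Integrable fun y => slope (fun u => f (fill1 j u y)) a t := by
    intro t
    simp only [slope_def_field]
    exact ((hint t).sub (hint a)).div_const _
  refine (tendsto_setIntegral_of_L1 _
    (measurable_deriv_comp_fill1 hcont j a).aestronglyMeasurable
    (Eventually.of_forall hslope) hlim B).congr fun t => ?_
  simp only [slope_def_field]
  rw [integral_div, integral_sub (hint t).restrict (hint a).restrict]

end Density


/-- regularity transfer: under conditions (i)–(iv) on a nonnegative
integrable density `f` on `ℝ^d`, for every nonempty `I ⊆ {1,…,d}` the partial
distribution function `F_I` is twice continuously differentiable with uniformly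
bounded first and second order derivatives. -/
theorem regularity_transfer
    (d : ℕ) (hd : 2 ≤ d) (f : (Fin d → ℝ) → ℝ)
    (hf0 : ∀ x, 0 ≤ f x)
    (hfint : Integrable f volume)
    -- (i): uniformly bounded univariate and bivariate marginals
    (hmarg1 : ∀ i : Fin d, ∃ K : ℝ, ∀ t : ℝ,
      ∫⁻ y : {k : Fin d // k ≠ i} → ℝ, ENNReal.ofReal (f (fill1 i t y)) ≤
        ENNReal.ofReal K)
    (hmarg2 : ∀ i j : Fin d, i ≠ j → ∃ K : ℝ, ∀ u v : ℝ,
      ∫⁻ y : {k : Fin d // k ≠ i ∧ k ≠ j} → ℝ, ENNReal.ofReal (f (fill2 i j u v y)) ≤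
        ENNReal.ofReal K)
    -- (ii): continuity of `f`, existence of the partial derivatives, and continuity of
    -- each partial derivative in its own coordinate
    (hcont : Continuous f)
    (hdiff : ∀ (j : Fin d) (x : Fin d → ℝ),
      DifferentiableAt ℝ (fun t => f (Function.update x j t)) (x j))
    (hpdcont : ∀ (j : Fin d) (y : {k : Fin d // k ≠ j} → ℝ),
      Continuous (fun t : ℝ => deriv (fun u => f (fill1 j u y)) t))
    -- (iii): local integrable majorants for the partial derivatives
    (hmaj : ∀ (a : ℝ) (j : Fin d), ∃ ε > (0 : ℝ),
      ∃ M : ({k : Fin d // k ≠ j} → ℝ) → ℝ,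
        (∀ y, 0 ≤ M y) ∧
        (∫⁻ y : {k : Fin d // k ≠ j} → ℝ, ENNReal.ofReal (M y)) < ⊤ ∧
        (∀ t : ℝ, |t - a| ≤ ε → ∀ y : {k : Fin d // k ≠ j} → ℝ,
          |deriv (fun u => f (fill1 j u y)) t| ≤ M y) ∧
        (∀ i : Fin d, i ≠ j → ∀ r : ℝ, 0 < r → ∃ K : ℝ, ∀ u : ℝ, |u| ≤ r →
          ∫⁻ z : {k : Fin d // k ≠ i ∧ k ≠ j} → ℝ,
            ENNReal.ofReal (M (fillSub j i u z)) ≤ ENNReal.ofReal K))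
    -- (iv): uniformly bounded integrals of the absolute partial derivatives
    (hpdint : ∀ j : Fin d, ∃ K : ℝ, ∀ t : ℝ,
      ∫⁻ y : {k : Fin d // k ≠ j} → ℝ,
        ENNReal.ofReal |deriv (fun u => f (fill1 j u y)) t| ≤ ENNReal.ofReal K) :
    ∀ I : Finset (Fin d), I.Nonempty →
      ContDiff ℝ 2 (cdfI d f I) ∧
      ∃ K : ℝ, ∀ z : {i : Fin d // i ∈ I} → ℝ,
        ‖fderiv ℝ (cdfI d f I) z‖ ≤ K ∧
        ‖fderiv ℝ (fderiv ℝ (cdfI d f I)) z‖ ≤ K := by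
  intro I _
  have habs : ∀ x, |f x| = f x := fun x => abs_of_nonneg (hf0 x)
  have hmarg1' : ∀ i : Fin d, ∃ K : ℝ, ∀ t : ℝ,
      ∫⁻ y, ENNReal.ofReal |f (fill1 i t y)| ≤ ENNReal.ofReal K := by
    simpa only [habs] using hmarg1
  have hmarg2' : ∀ i j : Fin d, i ≠ j → ∃ K : ℝ, ∀ u v : ℝ,
      ∫⁻ z, ENNReal.ofReal |f (fill1 j v (fillSub j i u z))| ≤ ENNReal.ofReal K := by
    intro i j hij
    simpa only [habs, fill1_fillSub_eq_fill2 hij] using hmarg2 i j hij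
  have hmaj' : LocallyMajorized f := hmaj
  have hint1 : ∀ (i : Fin d) (t : ℝ), Integrable fun y => f (fill1 i t y) := fun i t =>
    integrable_of_lintegral_le_ofReal
      (continuous_comp_fill1 hcont i t).aestronglyMeasurable ((hmarg1' i).choose_spec t)
  have hint2 : ∀ i j : Fin d, i ≠ j → ∀ u v : ℝ,
      Integrable fun z => f (fill1 j v (fillSub j i u z)) := fun i j hij u v =>
    integrable_of_lintegral_le_ofReal
      (continuous_comp_fill1_fillSub hcont i j u v).aestronglyMeasurable
      ((hmarg2' i j hij).choose_spec u v)
  have hintd : ∀ (j : Fin d) (t : ℝ), Integrable fun y => deriv (fun u => f (fill1 j u y)) t :=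
    fun j t => integrable_of_lintegral_le_ofReal
      (measurable_deriv_comp_fill1 hcont j t).aestronglyMeasurable ((hpdint j).choose_spec t)
  let G : {i : Fin d // i ∈ I} → ({i : Fin d // i ∈ I} → ℝ) → ℝ := fun i z =>
    ∫ y in lowerBox Subtype.val I z, f (fill1 i.1 (z i) y)
  let D : {i : Fin d // i ∈ I} → ({i : Fin d // i ∈ I} → ℝ) → ℝ := fun i z =>
    ∫ y in lowerBox Subtype.val I z, deriv (fun u => f (fill1 i.1 u y)) (z i)
  let E : {i : Fin d // i ∈ I} → {i : Fin d // i ∈ I} → ({i : Fin d // i ∈ I} → ℝ) → ℝ :=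
    fun i j z => ∫ w in lowerBox (fun k : {k : Fin d // k ≠ j.1 ∧ k ≠ i.1} => k.1) I z,
      f (fill1 i.1 (z i) (fillSub i.1 j.1 (z j) w))
  have hGc : ∀ i : Fin d, Continuous fun p : ℝ × ({i : Fin d // i ∈ I} → ℝ) =>
      ∫ y in lowerBox Subtype.val I p.2, f (fill1 i p.1 y) := fun i =>
    continuous_setIntegral_lowerBox_of_L1 (hint1 i)
      (tendsto_lintegral_enorm_fill1_sub hdiff hmaj' i)
  have hEc : ∀ i j : Fin d, j ≠ i → Continuous fun p : (ℝ × ℝ) × ({i : Fin d // i ∈ I} → ℝ) =>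
      ∫ w in lowerBox (fun k : {k : Fin d // k ≠ j ∧ k ≠ i} => k.1) I p.2,
        f (fill1 i p.1.1 (fillSub i j p.1.2 w)) := fun i j hij =>
    continuous_setIntegral_lowerBox_of_L1
      (G := fun p : ℝ × ℝ => fun w => f (fill1 i p.1 (fillSub i j p.2 w)))
      (fun p => hint2 j i hij p.2 p.1)
      (tendsto_lintegral_enorm_fill1_fillSub_sub hcont hdiff hmaj' hij)
  have hDc : ∀ i : Fin d, Continuous fun p : ℝ × ({i : Fin d // i ∈ I} → ℝ) =>
      ∫ y in lowerBox Subtype.val I p.2, deriv (fun u => f (fill1 i u y)) p.1 := fun i =>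
    continuous_setIntegral_lowerBox_of_L1 (hintd i)
      (tendsto_lintegral_enorm_deriv_sub hcont hpdcont hmaj' i)
  have hpair : ∀ i : {i : Fin d // i ∈ I},
      Continuous fun z : {i : Fin d // i ∈ I} → ℝ => (z i, z) := fun i => by fun_prop
  have htriple : ∀ i j : {i : Fin d // i ∈ I},
      Continuous fun z : {i : Fin d // i ∈ I} → ℝ => ((z i, z j), z) := fun i j => by fun_prop
  have hG : HasPartialsBdd (cdfI d f I) G := by
    refine fun i => ⟨(hGc i.1).comp (hpair i), ?_, fun z => ?_⟩
    · obtain ⟨K, hK⟩ := hmarg1' i.1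
      exact ⟨_, fun z => abs_setIntegral_le_of_lintegral_le (hK (z i)) _⟩
    · simp only [cdfI_eq_setIntegral_lowerBox]
      exact hasDerivAt_setIntegral_of_measurePreserving (measurePreserving_fill1 i.1) hfint
        (fun t => measurableSet_lowerBox _)
        (fun t s y => mem_lowerBox_update_iff Function.injective_id (bijective_elim_val i.1)
          (fill1_self i.1 s y) (fill1_val i.1 s y) i rfl z t)
        ((hGc i.1).comp (Continuous.prodMk_left z)) (z i)
  have hH : ∀ i, HasPartialsBdd (G i) fun j => if j = i then D i else E i j := by
    intro i j
    by_cases hji : j = i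
    · subst hji
      simp only [if_true]
      refine ⟨(hDc j.1).comp (hpair j), ?_, fun z => ?_⟩
      · obtain ⟨K, hK⟩ := hpdint j.1
        exact ⟨_, fun z => abs_setIntegral_le_of_lintegral_le (hK (z j)) _⟩
      · simp only [G, lowerBox_val_update, Function.update_self]
        exact hasDerivAt_setIntegral_fill1 hcont hdiff hmaj' (hint1 j.1) _ (z j)
    · have hne : j.1 ≠ i.1 := fun h => hji (Subtype.ext h)
      simp only [if_neg hji]
      refine ⟨(hEc i.1 j.1 hne).comp (htriple i j), ?_, fun z => ?_⟩
      · obtain ⟨K, hK⟩ := hmarg2' j.1 i.1 hne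
        exact ⟨_, fun z => abs_setIntegral_le_of_lintegral_le (hK (z j) (z i)) _⟩
      · simp only [G, Function.update_of_ne (Ne.symm hji)]
        exact hasDerivAt_setIntegral_of_measurePreserving (measurePreserving_fillSub hne)
          (hint1 i.1 (z i)) (fun t => measurableSet_lowerBox _)
          (fun t s w => mem_lowerBox_update_iff Subtype.val_injective (bijective_elim_pair hne)
            (fillSub_self hne s w) (fillSub_val j.1 i.1 s w) j rfl z t)
          ((hEc i.1 j.1 hne).comp
            (((Continuous.prodMk_right (z i)).prodMk continuous_const : Continuous fun s : ℝ =>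
              ((z i, s), z)))) (z j)
  exact hG.contDiff_two hH
end

section
/- Let d ≥ 2 and let ν be a Borel measure on [0,∞)^d satisfying the marginal constraint ν({y ∈ [0,∞)^d : y_i > z}) = 1/z for every z > 0 and every i ∈ {1,…,d}. For a nonempty subset I ⊆ {1,…,d} define R_I(x) := ν({y ∈ [0,∞)^d : y_i ≥ 1/x_i for all i ∈ I}) for x ∈ (0,∞)^I. Then R_I is 1-Lipschitz with respect to the ℓ¹-norm: |R_I(x) − R_I(x')| ≤ Σ_{i∈I} |x_i − x_i'| for all x, x' ∈ (0,∞)^I. -/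
open MeasureTheory Finset

section TailSets

variable {ι : Type*} {ν : Measure (ι → ℝ)}

/-- The marginal tail condition determines the mass of the closed tail sets as well. -/
lemma measure_closed_tail {i : ι}
    (hmarg : ∀ z : ℝ, 0 < z →
      ν {y : ι → ℝ | (∀ k, 0 ≤ y k) ∧ z < y i} = ENNReal.ofReal (1 / z))
    {z : ℝ} (hz : 0 < z) :
    ν {y : ι → ℝ | (∀ k, 0 ≤ y k) ∧ z ≤ y i} = ENNReal.ofReal (1 / z) := by
  apply le_antisymm
  · have hlim : Filter.Tendsto (fun w : ℝ => ENNReal.ofReal (1 / w)) (nhdsWithin z (Set.Iio z))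
        (nhds (ENNReal.ofReal (1 / z))) :=
      ((ENNReal.continuous_ofReal.tendsto _).comp
        (tendsto_const_nhds.div Filter.tendsto_id hz.ne')).mono_left nhdsWithin_le_nhds
    refine ge_of_tendsto hlim ?_
    filter_upwards [Ioo_mem_nhdsLT hz] with w hw
    rw [← hmarg w hw.1]
    exact measure_mono fun y hy => ⟨hy.1, hw.2.trans_le hy.2⟩
  · rw [← hmarg z hz]
    exact measure_mono fun y hy => ⟨hy.1, hy.2.le⟩

lemma measure_closed_tail_diff_le [Countable ι] {i : ι}
    (hmarg : ∀ z : ℝ, 0 < z →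
      ν {y : ι → ℝ | (∀ k, 0 ≤ y k) ∧ z < y i} = ENNReal.ofReal (1 / z))
    {a b : ℝ} (ha : 0 < a) (hb : 0 < b) :
    ν ({y : ι → ℝ | (∀ k, 0 ≤ y k) ∧ 1 / a ≤ y i} \ {y | (∀ k, 0 ≤ y k) ∧ 1 / b ≤ y i}) ≤
      ENNReal.ofReal |a - b| := by
  have htail {c : ℝ} (hc : 0 < c) :
      ν {y : ι → ℝ | (∀ k, 0 ≤ y k) ∧ 1 / c ≤ y i} = ENNReal.ofReal c := by
    rw [measure_closed_tail hmarg (one_div_pos.2 hc), one_div_one_div]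
  have hanti {c e : ℝ} (hc : 0 < c) (hce : c ≤ e) :
      {y : ι → ℝ | (∀ k, 0 ≤ y k) ∧ 1 / c ≤ y i} ⊆ {y | (∀ k, 0 ≤ y k) ∧ 1 / e ≤ y i} :=
    fun y hy => ⟨hy.1, (one_div_le_one_div_of_le hc hce).trans hy.2⟩
  rcases le_total a b with hab | hab
  · rw [Set.sdiff_eq_empty.2 (hanti ha hab)]
    simp
  · have hmeas : MeasurableSet {y : ι → ℝ | (∀ k, 0 ≤ y k) ∧ 1 / b ≤ y i} := by
      measurability
    rw [measure_sdiff (hanti hb hab) hmeas.nullMeasurableSet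
      (by rw [htail hb]; exact ENNReal.ofReal_ne_top), htail ha, htail hb,
      ← ENNReal.ofReal_sub _ hb.le]
    exact ENNReal.ofReal_le_ofReal (le_abs_self _)

lemma measure_joint_tail_le_add [Countable ι]
    (hmarg : ∀ i : ι, ∀ z : ℝ, 0 < z →
      ν {y : ι → ℝ | (∀ k, 0 ≤ y k) ∧ z < y i} = ENNReal.ofReal (1 / z))
    (I : Finset ι) {x x' : {i : ι // i ∈ I} → ℝ} (hx : ∀ i, 0 < x i) (hx' : ∀ i, 0 < x' i) :
    ν {y : ι → ℝ | (∀ k, 0 ≤ y k) ∧ ∀ i : {i : ι // i ∈ I}, 1 / x i ≤ y i.1} ≤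
      ν {y : ι → ℝ | (∀ k, 0 ≤ y k) ∧ ∀ i : {i : ι // i ∈ I}, 1 / x' i ≤ y i.1} +
        ENNReal.ofReal (∑ i : {i : ι // i ∈ I}, |x i - x' i|) := by
  have hsub : {y : ι → ℝ | (∀ k, 0 ≤ y k) ∧ ∀ i : {i : ι // i ∈ I}, 1 / x i ≤ y i.1} ⊆
      {y : ι → ℝ | (∀ k, 0 ≤ y k) ∧ ∀ i : {i : ι // i ∈ I}, 1 / x' i ≤ y i.1} ∪
        ⋃ i : {i : ι // i ∈ I}, ({y : ι → ℝ | (∀ k, 0 ≤ y k) ∧ 1 / x i ≤ y i.1} \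
          {y | (∀ k, 0 ≤ y k) ∧ 1 / x' i ≤ y i.1}) := by
    intro y hy
    by_cases h : ∀ i : {i : ι // i ∈ I}, 1 / x' i ≤ y i.1
    · exact Or.inl ⟨hy.1, h⟩
    · obtain ⟨i, hi⟩ := not_forall.1 h
      exact Or.inr (Set.mem_iUnion.2 ⟨i, ⟨hy.1, hy.2 i⟩, fun h' => hi h'.2⟩)
  refine (measure_mono hsub).trans ((measure_union_le _ _).trans ?_)
  gcongr
  rw [ENNReal.ofReal_sum_of_nonneg fun i _ => abs_nonneg _]
  exact (measure_iUnion_fintype_le ν _).trans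
    (Finset.sum_le_sum fun i _ => measure_closed_tail_diff_le (hmarg i.1) (hx i) (hx' i))

lemma measure_joint_tail_ne_top
    (hmarg : ∀ i : ι, ∀ z : ℝ, 0 < z →
      ν {y : ι → ℝ | (∀ k, 0 ≤ y k) ∧ z < y i} = ENNReal.ofReal (1 / z))
    {I : Finset ι} (hI : I.Nonempty) {x : {i : ι // i ∈ I} → ℝ} (hx : ∀ i, 0 < x i) :
    ν {y : ι → ℝ | (∀ k, 0 ≤ y k) ∧ ∀ i : {i : ι // i ∈ I}, 1 / x i ≤ y i.1} ≠ ⊤ := by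
  obtain ⟨i, hi⟩ := hI
  have hsub : {y : ι → ℝ | (∀ k, 0 ≤ y k) ∧ ∀ j : {i : ι // i ∈ I}, 1 / x j ≤ y j.1} ⊆
      {y | (∀ k, 0 ≤ y k) ∧ 1 / x ⟨i, hi⟩ ≤ y i} :=
    fun y hy => ⟨hy.1, hy.2 ⟨i, hi⟩⟩
  refine measure_ne_top_of_subset hsub ?_
  rw [measure_closed_tail (hmarg i) (one_div_pos.2 (hx _))]
  exact ENNReal.ofReal_ne_top

lemma toReal_measure_joint_tail_sub_le [Countable ι]
    (hmarg : ∀ i : ι, ∀ z : ℝ, 0 < z →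
      ν {y : ι → ℝ | (∀ k, 0 ≤ y k) ∧ z < y i} = ENNReal.ofReal (1 / z))
    {I : Finset ι} (hI : I.Nonempty) {x x' : {i : ι // i ∈ I} → ℝ}
    (hx : ∀ i, 0 < x i) (hx' : ∀ i, 0 < x' i) :
    (ν {y : ι → ℝ | (∀ k, 0 ≤ y k) ∧ ∀ i : {i : ι // i ∈ I}, 1 / x i ≤ y i.1}).toReal -
      (ν {y : ι → ℝ | (∀ k, 0 ≤ y k) ∧ ∀ i : {i : ι // i ∈ I}, 1 / x' i ≤ y i.1}).toReal ≤
      ∑ i : {i : ι // i ∈ I}, |x i - x' i| := by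
  have hfin := measure_joint_tail_ne_top hmarg hI hx'
  have h := ENNReal.toReal_mono (ENNReal.add_ne_top.2 ⟨hfin, ENNReal.ofReal_ne_top⟩)
    (measure_joint_tail_le_add hmarg I hx hx')
  rw [ENNReal.toReal_add hfin ENNReal.ofReal_ne_top,
    ENNReal.toReal_ofReal (Finset.sum_nonneg fun i _ => abs_nonneg _)] at h
  linarith

end TailSets

/-- for a Borel measure `ν` on `[0,∞)^d` with standardized marginal
tails `ν({y : y_i > z}) = 1/z`, the function
`R_I(x) = ν({y : y_i ≥ 1/x_i ∀ i ∈ I})` is 1-Lipschitz with respect to the ℓ¹-norm. -/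
theorem tail_function_lipschitz
    (d : ℕ) (hd : 2 ≤ d) (ν : Measure (Fin d → ℝ))
    (hsupp : ν {y : Fin d → ℝ | ¬ ∀ i, 0 ≤ y i} = 0)
    (hmarg : ∀ i : Fin d, ∀ z : ℝ, 0 < z →
      ν {y : Fin d → ℝ | (∀ k, 0 ≤ y k) ∧ z < y i} = ENNReal.ofReal (1 / z))
    (I : Finset (Fin d)) (hI : I.Nonempty)
    (x x' : {i : Fin d // i ∈ I} → ℝ) (hx : ∀ i, 0 < x i) (hx' : ∀ i, 0 < x' i) :
    |(ν {y : Fin d → ℝ | (∀ k, 0 ≤ y k) ∧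
          ∀ i : {i : Fin d // i ∈ I}, 1 / x i ≤ y i.1}).toReal -
      (ν {y : Fin d → ℝ | (∀ k, 0 ≤ y k) ∧
          ∀ i : {i : Fin d // i ∈ I}, 1 / x' i ≤ y i.1}).toReal| ≤
    ∑ i : {i : Fin d // i ∈ I}, |x i - x' i| := by
  refine abs_sub_le_iff.2 ⟨toReal_measure_joint_tail_sub_le hmarg hI hx hx', ?_⟩
  simpa only [abs_sub_comm] using toReal_measure_joint_tail_sub_le hmarg hI hx' hx
end
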